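/- Let λ be the Lyapunov exponent of the i.i.d. random product of A and B, and let κ = Σ_{a,b=1}^∞ 2^{−a−b} log(ab). Then κ + log(αβ) ≤ 4λ ≤ κ + log(√(αβ) + 1/√(αβ)) + ½ log(1 + αβ). -/

import Mathlib

open Filter

noncomputable section

/-- `M_i = A_{i_N} ⋯ A_{i_1}`, where index value `0` selects `A` and `1` selects `B`. -/
def wordProd (A B : Matrix (Fin 2) (Fin 2) ℝ) (N : ℕ) (i : Fin N → Fin 2) :
    Matrix (Fin 2) (Fin 2) ℝ :=
  ((List.ofFn fun k => if i k = 0 then A else B).reverse).prod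

/-- The Euclidean norm on ℝ². -/
def nrm2 (x : Fin 2 → ℝ) : ℝ := Real.sqrt ((x 0) ^ 2 + (x 1) ^ 2)

/-- `κ = Σ_{a,b=1}^∞ 2^{-a-b} log (a b)`. -/
def kappa : ℝ :=
  ∑' (a : ℕ) (b : ℕ), ((2 : ℝ) ^ (a + b + 2))⁻¹ * Real.log ((a + 1) * (b + 1))

lemma wordProd_cons (A B : Matrix (Fin 2) (Fin 2) ℝ) (N : ℕ) (j : Fin 2) (i : Fin N → Fin 2) :
    wordProd A B (N + 1) (Fin.cons j i) = wordProd A B N i * (if j = 0 then A else B) := by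
  simp [wordProd, List.ofFn_succ]

lemma sum_word_succ (A B : Matrix (Fin 2) (Fin 2) ℝ) (F : (Fin 2 → ℝ) → ℝ) (N : ℕ)
    (x : Fin 2 → ℝ) :
    ∑ i : Fin (N + 1) → Fin 2, F ((wordProd A B (N + 1) i).mulVec x) =
      ∑ i : Fin N → Fin 2, F ((wordProd A B N i).mulVec (A.mulVec x)) +
      ∑ i : Fin N → Fin 2, F ((wordProd A B N i).mulVec (B.mulVec x)) := by
  rw [← (Fin.consEquiv (fun _ : Fin (N + 1) => Fin 2)).sum_comp, Fintype.sum_prod_type,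
    Fin.sum_univ_two]
  simp only [Matrix.mulVec_mulVec]
  simp [Fin.consEquiv, wordProd_cons, -Matrix.mulVec_fin_two]

lemma generic_lower (A B : Matrix (Fin 2) (Fin 2) ℝ) (F : (Fin 2 → ℝ) → ℝ)
    (R : (Fin 2 → ℝ) → ℝ → Prop) (ρ : ℝ)
    (h1 : ∀ x φ, R x φ → ∃ p q, R (A.mulVec x) p ∧ R (B.mulVec x) q ∧ 2 * φ + 2 * ρ ≤ p + q)
    (h2 : ∀ x φ, R x φ → φ ≤ F x) (N : ℕ) : ∀ x φ, R x φ →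
      (2 : ℝ) ^ N * (ρ * N + φ) ≤ ∑ i : Fin N → Fin 2, F ((wordProd A B N i).mulVec x) := by
  induction N with
  | zero =>
    intro x φ h
    simpa [wordProd] using h2 x φ h
  | succ N ih =>
    intro x φ h
    obtain ⟨p, q, hp, hq, hpq⟩ := h1 x φ h
    rw [sum_word_succ]
    have e1 := ih _ _ hp
    have e2 := ih _ _ hq
    have hpow : (0 : ℝ) < 2 ^ N := by positivity
    have := mul_le_mul_of_nonneg_left hpq hpow.le
    push_cast
    rw [pow_succ]
    nlinarith

lemma limit_lower (S : ℕ → ℝ) (ρ φ lam : ℝ)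
    (hS : ∀ N : ℕ, (2 : ℝ) ^ N * (ρ * N + φ) ≤ S N)
    (hl : Tendsto (fun N : ℕ => ((N : ℝ))⁻¹ * ((2 : ℝ) ^ N)⁻¹ * S N) atTop (nhds lam)) :
    ρ ≤ lam := by
  have h0 : Tendsto (fun N : ℕ => ρ + φ * ((N : ℝ))⁻¹) atTop (nhds (ρ + φ * 0)) :=
    tendsto_const_nhds.add (tendsto_const_nhds.mul tendsto_inv_atTop_nhds_zero_nat)
  rw [mul_zero, add_zero] at h0
  refine le_of_tendsto_of_tendsto h0 hl ?_
  filter_upwards [eventually_gt_atTop 0] with N hN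
  have hN' : (0 : ℝ) < N := by exact_mod_cast hN
  have := mul_le_mul_of_nonneg_left (hS N)
    (show (0 : ℝ) ≤ ((N : ℝ))⁻¹ * ((2 : ℝ) ^ N)⁻¹ by positivity)
  refine le_trans (le_of_eq ?_) this
  field_simp

/-- Averaged logarithm. -/
def GG (a : ℕ) : ℝ := ∑' k : ℕ, (1 / 2 : ℝ) ^ (k + 1) * Real.log ((a : ℝ) + k + 1)

lemma summable_half : HasSum (fun k : ℕ => (1 / 2 : ℝ) ^ (k + 1)) 1 := by
  have := hasSum_geometric_two.mul_left (1 / 2 : ℝ)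
  simpa [pow_succ, mul_comm] using this

lemma log_nn (a k : ℕ) : 0 ≤ Real.log ((a : ℝ) + k + 1) :=
  Real.log_nonneg (by have : (0 : ℝ) ≤ a := a.cast_nonneg
                      have : (0 : ℝ) ≤ k := k.cast_nonneg
                      linarith)

lemma summable_GG0 : Summable (fun k : ℕ => (1 / 2 : ℝ) ^ (k + 1) * Real.log ((k : ℝ) + 1)) := by
  have h1 : Summable (fun k : ℕ => (k : ℝ) ^ 1 * (1 / 2 : ℝ) ^ k) :=
    summable_pow_mul_geometric_of_norm_lt_one 1 (by norm_num)
  refine Summable.of_nonneg_of_le (fun k => ?_) (fun k => ?_) h1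
  · have := log_nn 0 k
    simp only [Nat.cast_zero, zero_add] at this
    positivity
  · have hk : (0 : ℝ) ≤ k := k.cast_nonneg
    have := Real.log_le_sub_one_of_pos (show (0 : ℝ) < k + 1 by positivity)
    have hp : (0 : ℝ) < (1 / 2) ^ k := by positivity
    rw [pow_succ, pow_one]
    nlinarith [mul_nonneg hp.le hk, mul_le_mul_of_nonneg_left this hp.le]

lemma log_split (a k : ℕ) :
    Real.log ((a : ℝ) + k + 1) ≤ Real.log ((a : ℝ) + 1) + Real.log ((k : ℝ) + 1) := by
  have ha : (0 : ℝ) ≤ a := a.cast_nonneg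
  have hk : (0 : ℝ) ≤ k := k.cast_nonneg
  rw [← Real.log_mul (by positivity) (by positivity)]
  apply Real.log_le_log (by positivity)
  nlinarith [mul_nonneg ha hk]

lemma summable_bd (a : ℕ) : HasSum (fun k : ℕ => (1 / 2 : ℝ) ^ (k + 1) *
    (Real.log ((a : ℝ) + 1) + Real.log ((k : ℝ) + 1))) (Real.log ((a : ℝ) + 1) + GG 0) := by
  have h1 := summable_half.mul_right (Real.log ((a : ℝ) + 1))
  have h2 := summable_GG0.hasSum
  have := h1.add h2
  simp only [one_mul] at this
  simpa [GG, mul_add] using this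

lemma summable_GG (a : ℕ) :
    Summable (fun k : ℕ => (1 / 2 : ℝ) ^ (k + 1) * Real.log ((a : ℝ) + k + 1)) := by
  refine Summable.of_nonneg_of_le (fun k => ?_) (fun k => ?_) (summable_bd a).summable
  · have := log_nn a k
    positivity
  · exact mul_le_mul_of_nonneg_left (log_split a k) (by positivity)

lemma GG_le (a : ℕ) : GG a ≤ Real.log ((a : ℝ) + 1) + GG 0 := by
  rw [← (summable_bd a).tsum_eq]
  exact (summable_GG a).tsum_le_tsum
    (fun k => mul_le_mul_of_nonneg_left (log_split a k) (by positivity)) (summable_bd a).summable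

lemma le_GG (a : ℕ) : Real.log ((a : ℝ) + 1) ≤ GG a := by
  have h1 := summable_half.mul_right (Real.log ((a : ℝ) + 1))
  rw [one_mul] at h1
  rw [← h1.tsum_eq]
  refine h1.summable.tsum_le_tsum (fun k => ?_) (summable_GG a)
  refine mul_le_mul_of_nonneg_left ?_ (by positivity)
  apply Real.log_le_log (by positivity)
  have : (0 : ℝ) ≤ k := k.cast_nonneg
  linarith

lemma GG_rec (a : ℕ) : 2 * GG a = Real.log ((a : ℝ) + 1) + GG (a + 1) := by
  have h : GG a = (1 / 2 : ℝ) * Real.log ((a : ℝ) + 1) + (1 / 2) * GG (a + 1) := by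
    rw [GG, (summable_GG a).tsum_eq_zero_add, GG, ← tsum_mul_left]
    congr 1
    · simp
    · refine tsum_congr fun k => ?_
      push_cast
      rw [pow_succ _ (k + 1)]
      ring_nf
  linarith

lemma kappa_eq : kappa = 2 * GG 0 := by
  have inner : ∀ a : ℕ, ∑' b : ℕ, ((2 : ℝ) ^ (a + b + 2))⁻¹ * Real.log (((a : ℝ) + 1) * (b + 1)) =
      (1 / 2 : ℝ) ^ (a + 1) * (Real.log ((a : ℝ) + 1) + GG 0) := by
    intro a
    rw [← (summable_bd a).tsum_eq, ← tsum_mul_left]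
    refine tsum_congr fun b => ?_
    rw [Real.log_mul (by positivity) (by positivity), ← mul_assoc, ← pow_add, one_div, inv_pow]
    congr 3
    ring
  rw [kappa, tsum_congr inner]
  have h1 := summable_GG0.hasSum.add (summable_half.mul_right (GG 0))
  simp only [← mul_add, one_mul] at h1
  rw [h1.tsum_eq]
  have : GG 0 = ∑' k : ℕ, (1 / 2 : ℝ) ^ (k + 1) * Real.log ((k : ℝ) + 1) := by simp [GG]
  rw [← this]
  ring

lemma step_low (α u v : ℝ) (a : ℕ) (hα : 1 ≤ α) (hu : 0 < u) (h : (a + 1) * α * u ≤ v) :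
    Real.log u + Real.log ((a : ℝ) + 1) + Real.log α ≤ Real.log v := by
  have hα0 : 0 < α := by linarith
  calc Real.log u + Real.log ((a : ℝ) + 1) + Real.log α = Real.log ((a + 1) * α * u) := by
        rw [Real.log_mul (by positivity) (by positivity),
          Real.log_mul (by positivity) (by positivity)]
        ring
    _ ≤ Real.log v := Real.log_le_log (by positivity) h

/-- Upper bound for the correction term. -/
def gbar (L : ℝ) (a b : ℕ) : ℝ := if a = 0 ∧ b = 0 then L else 2 * L / 3

/-- Potential for the correction term. -/
def HH (L : ℝ) (a b : ℕ) : ℝ := if a = 0 then (if b = 0 then L / 4 else L / 12) else 0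

lemma HH_rec (L : ℝ) (a b : ℕ) :
    HH L (a + 1) b + gbar L a b + HH L 0 a = 2 * HH L a b + 3 * L / 4 := by
  unfold HH gbar
  by_cases ha : a = 0 <;> by_cases hb : b = 0 <;> simp [ha, hb] <;> ring

lemma HH_nonneg (L : ℝ) (hL : 0 ≤ L) (a b : ℕ) : 0 ≤ HH L a b := by
  unfold HH
  split_ifs <;> linarith

lemma log_corr (c : ℝ) (hc : 1 ≤ c) (a b : ℕ) :
    Real.log (1 + 1 / ((a + 1) * (b + 1) * c)) ≤ gbar (Real.log (1 + 1 / c)) a b := by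
  have hc0 : 0 < c := by linarith
  unfold gbar
  split_ifs with h
  · simp [h.1, h.2]
  · have hab : (2 : ℝ) ≤ (a + 1) * (b + 1) := by
      have : 2 ≤ (a + 1) * (b + 1) := by
        rcases Nat.eq_zero_or_pos a with h1 | h1
        · have : b ≠ 0 := fun h2 => h ⟨h1, h2⟩
          subst h1
          omega
        · nlinarith [Nat.zero_le b, Nat.zero_le (a * b)]
      exact_mod_cast this
    have h1 : Real.log (1 + 1 / ((a + 1) * (b + 1) * c)) ≤ Real.log (1 + 1 / (2 * c)) := by
      apply Real.log_le_log (by positivity)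
      gcongr
    have h2 : Real.log ((1 + 1 / (2 * c)) ^ 3) ≤ Real.log ((1 + 1 / c) ^ 2) := by
      apply Real.log_le_log (by positivity)
      have e : 1 / (2 * c) = (1 / c) / 2 := by field_simp
      rw [e]
      have t0 : 0 < 1 / c := by positivity
      have t1 : 1 / c ≤ 1 := by rw [div_le_one hc0]; exact hc
      generalize 1 / c = t at *
      nlinarith [mul_nonneg t0.le (sub_nonneg.2 t1), mul_nonneg (mul_nonneg t0.le t0.le) (sub_nonneg.2 t1)]
    rw [Real.log_pow, Real.log_pow] at h2
    push_cast at h2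
    linarith

lemma step_up (α β u v0 : ℝ) (a b : ℕ) (hα : 1 ≤ α) (hβ : 1 ≤ β) (hu : 0 < u) (hv : 0 ≤ v0)
    (h : (b + 1) * β * v0 ≤ u) :
    Real.log (v0 + (a + 1) * α * u) ≤ Real.log u + Real.log ((a : ℝ) + 1) + Real.log α
      + gbar (Real.log (1 + 1 / (α * β))) a b := by
  have hα0 : 0 < α := by linarith
  have hβ0 : 0 < β := by linarith
  have hc := log_corr (α * β) (by nlinarith) a b
  have hle : v0 + (a + 1) * α * u ≤ (a + 1) * α * u * (1 + 1 / ((a + 1) * (b + 1) * (α * β))) := by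
    have e : (a + 1) * α * u * (1 + 1 / ((a + 1) * (b + 1) * (α * β))) =
      u / ((b + 1) * β) + (a + 1) * α * u := by field_simp; ring
    rw [e]
    have : v0 ≤ u / ((b + 1) * β) := by
      rw [le_div_iff₀ (by positivity)]
      linarith
    linarith
  have := Real.log_le_log (by positivity) hle
  rw [Real.log_mul (by positivity) (by positivity),
          Real.log_mul (by positivity) (by positivity),
          Real.log_mul (by positivity) (by positivity)] at this
  linarith

lemma le_nrm2_0 (x : Fin 2 → ℝ) : x 0 ≤ nrm2 x :=
  Real.le_sqrt_of_sq_le (by nlinarith [sq_nonneg (x 1)])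

lemma le_nrm2_1 (x : Fin 2 → ℝ) : x 1 ≤ nrm2 x :=
  Real.le_sqrt_of_sq_le (by nlinarith [sq_nonneg (x 0)])

lemma nrm2_le (x : Fin 2 → ℝ) (h0 : 0 ≤ x 0) (h1 : 0 ≤ x 1) : nrm2 x ≤ x 0 + x 1 := by
  unfold nrm2
  rw [Real.sqrt_le_left (by positivity)]
  nlinarith [mul_nonneg h0 h1]

lemma norm_up (α β u v0 s : ℝ) (a b : ℕ) (hα : 1 ≤ α) (hβ : 1 ≤ β) (hu : 0 < u) (hv : 0 ≤ v0)
    (h : (b + 1) * β * v0 ≤ u) (hs0 : 0 < s) (hs : s ≤ u + (v0 + (a + 1) * α * u)) :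
    Real.log s ≤ Real.log u + GG a + Real.log (2 + α) := by
  have ha : (0 : ℝ) ≤ a := a.cast_nonneg
  have hb : (0 : ℝ) ≤ b := b.cast_nonneg
  have hv' : v0 ≤ u := by nlinarith [mul_nonneg hb hv, mul_nonneg (mul_nonneg hb hv) (sub_nonneg.2 hβ), mul_nonneg hv (sub_nonneg.2 hβ)]
  have hle : s ≤ u * (a + 1) * (2 + α) := by nlinarith [mul_nonneg ha hu.le]
  have := Real.log_le_log hs0 hle
  rw [Real.log_mul (by positivity) (by positivity),
    Real.log_mul (by positivity) (by positivity)] at this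
  linarith [le_GG a]

/-- States and potentials for the lower bound. -/
def RL (α β Φ : ℝ) (x : Fin 2 → ℝ) (φ : ℝ) : Prop :=
  (∃ a : ℕ, 0 < x 0 ∧ (a + 1) * α * x 0 ≤ x 1 ∧
    φ = Real.log (x 0) + GG a + Real.log α / 2 - GG 0) ∨
  (∃ a : ℕ, 0 < x 1 ∧ (a + 1) * β * x 1 ≤ x 0 ∧
    φ = Real.log (x 1) + GG a + Real.log β / 2 - GG 0) ∨
  (x = ![0, 1] ∧ φ = Φ)

/-- States and potentials for the upper bound. -/
def RU (α β L C Φ : ℝ) (x : Fin 2 → ℝ) (φ : ℝ) : Prop :=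
  (∃ a b : ℕ, ∃ w : ℝ, 0 < x 0 ∧ 0 ≤ w ∧ x 1 = w + (a + 1) * α * x 0 ∧ (b + 1) * β * w ≤ x 0 ∧
    φ = -(Real.log (x 0) + GG a + HH L a b + Real.log α / 2 + C)) ∨
  (∃ a b : ℕ, ∃ w : ℝ, 0 < x 1 ∧ 0 ≤ w ∧ x 0 = w + (a + 1) * β * x 1 ∧ (b + 1) * α * w ≤ x 1 ∧
    φ = -(Real.log (x 1) + GG a + HH L a b + Real.log β / 2 + C)) ∨
  (x = ![0, 1] ∧ φ = -Φ)

lemma mulA0 (α : ℝ) (x : Fin 2 → ℝ) : (!![1, 0; α, 1] : Matrix _ _ ℝ).mulVec x 0 = x 0 := by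
  simp [Matrix.mulVec, dotProduct, Fin.sum_univ_two]
lemma mulA1 (α : ℝ) (x : Fin 2 → ℝ) :
    (!![1, 0; α, 1] : Matrix _ _ ℝ).mulVec x 1 = α * x 0 + x 1 := by
  simp [Matrix.mulVec, dotProduct, Fin.sum_univ_two]
lemma mulB0 (β : ℝ) (x : Fin 2 → ℝ) :
    (!![1, β; 0, 1] : Matrix _ _ ℝ).mulVec x 0 = x 0 + β * x 1 := by
  simp [Matrix.mulVec, dotProduct, Fin.sum_univ_two]
lemma mulB1 (β : ℝ) (x : Fin 2 → ℝ) : (!![1, β; 0, 1] : Matrix _ _ ℝ).mulVec x 1 = x 1 := by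
  simp [Matrix.mulVec, dotProduct, Fin.sum_univ_two]
lemma mulA_init (α : ℝ) : (!![1, 0; α, 1] : Matrix _ _ ℝ).mulVec ![0, 1] = ![0, 1] := by
  ext i; fin_cases i <;> simp [Matrix.mulVec, dotProduct, Fin.sum_univ_two]

lemma RL_step (α β ρ Φ : ℝ) (hα : 1 ≤ α) (hβ : 1 ≤ β)
    (hρ : 2 * ρ = GG 0 + (Real.log α + Real.log β) / 2)
    (hΦ : Φ ≤ Real.log β / 2 - 2 * ρ) (x : Fin 2 → ℝ) (φ : ℝ) (h : RL α β Φ x φ) :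
    ∃ p q, RL α β Φ ((!![1, 0; α, 1] : Matrix _ _ ℝ).mulVec x) p ∧
      RL α β Φ ((!![1, β; 0, 1] : Matrix _ _ ℝ).mulVec x) q ∧ 2 * φ + 2 * ρ ≤ p + q := by
  rcases h with ⟨a, hu, hv, rfl⟩ | ⟨a, hu, hv, rfl⟩ | ⟨rfl, rfl⟩
  · have hv1 : 0 < x 1 := lt_of_lt_of_le (by positivity) hv
    refine ⟨_, _, Or.inl ⟨a + 1, ?_, ?_, rfl⟩, Or.inr (Or.inl ⟨0, ?_, ?_, rfl⟩), ?_⟩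
    · rwa [mulA0]
    · rw [mulA0, mulA1]; push_cast; linarith
    · rwa [mulB1]
    · rw [mulB0, mulB1]; push_cast; linarith
    · rw [mulA0, mulB1]
      linarith [GG_rec a, step_low α _ _ a hα hu hv]
  · have hv1 : 0 < x 0 := lt_of_lt_of_le (by positivity) hv
    refine ⟨_, _, Or.inl ⟨0, ?_, ?_, rfl⟩, Or.inr (Or.inl ⟨a + 1, ?_, ?_, rfl⟩), ?_⟩
    · rwa [mulA0]
    · rw [mulA0, mulA1]; push_cast; linarith
    · rwa [mulB1]
    · rw [mulB0, mulB1]; push_cast; linarith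
    · rw [mulA0, mulB1]
      linarith [GG_rec a, step_low β _ _ a hβ hu hv]
  · refine ⟨_, _, Or.inr (Or.inr ⟨mulA_init α, rfl⟩), Or.inr (Or.inl ⟨0, ?_, ?_, rfl⟩), ?_⟩
    · rw [mulB1]; simp
    · rw [mulB0, mulB1]; simp
    · rw [mulB1]; simp; linarith

lemma RL_norm (α β Φ : ℝ) (hα : 1 ≤ α) (hβ : 1 ≤ β)
    (hΦ : Φ ≤ 0) (x : Fin 2 → ℝ) (φ : ℝ) (h : RL α β Φ x φ) :
    φ ≤ Real.log (nrm2 x) := by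
  have lα := Real.log_nonneg hα
  have lβ := Real.log_nonneg hβ
  rcases h with ⟨a, hu, hv, rfl⟩ | ⟨a, hu, hv, rfl⟩ | ⟨rfl, rfl⟩
  · have hv1 : 0 < x 1 := lt_of_lt_of_le (by positivity) hv
    linarith [GG_le a, step_low α _ _ a hα hu hv, Real.log_le_log hv1 (le_nrm2_1 x)]
  · have hv1 : 0 < x 0 := lt_of_lt_of_le (by positivity) hv
    linarith [GG_le a, step_low β _ _ a hβ hu hv, Real.log_le_log hv1 (le_nrm2_0 x)]
  · simpa [nrm2] using hΦ

lemma RU_step (α β ρ L C Φ : ℝ) (hα : 1 ≤ α) (hβ : 1 ≤ β) (hL : L = Real.log (1 + 1 / (α * β)))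
    (hρ : 2 * ρ = GG 0 + (Real.log α + Real.log β) / 2 + 3 * L / 4)
    (hΦ : GG 0 + HH L 0 0 + Real.log β / 2 + C - 2 * ρ ≤ Φ)
    (x : Fin 2 → ℝ) (φ : ℝ) (h : RU α β L C Φ x φ) :
    ∃ p q, RU α β L C Φ ((!![1, 0; α, 1] : Matrix _ _ ℝ).mulVec x) p ∧
      RU α β L C Φ ((!![1, β; 0, 1] : Matrix _ _ ℝ).mulVec x) q ∧
      2 * φ + 2 * (-ρ) ≤ p + q := by
  rcases h with ⟨a, b, w, hu, hw, hv, hb, rfl⟩ | ⟨a, b, w, hu, hw, hv, hb, rfl⟩ | ⟨rfl, rfl⟩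
  · have hv1 : 0 < x 1 := by rw [hv]; positivity
    refine ⟨_, _, Or.inl ⟨a + 1, b, w, ?_, hw, ?_, ?_, rfl⟩,
      Or.inr (Or.inl ⟨0, a, x 0, ?_, hu.le, ?_, ?_, rfl⟩), ?_⟩
    · rwa [mulA0]
    · rw [mulA0, mulA1, hv]; push_cast; ring
    · rwa [mulA0]
    · rwa [mulB1]
    · rw [mulB0, mulB1]; push_cast; ring
    · rw [mulB1, hv]; linarith
    · rw [mulA0, mulB1]
      have := step_up α β (x 0) w a b hα hβ hu hw hb
      rw [← hv, ← hL] at this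
      linarith [GG_rec a, HH_rec L a b]
  · have hv1 : 0 < x 0 := by rw [hv]; positivity
    refine ⟨_, _, Or.inl ⟨0, a, x 1, ?_, hu.le, ?_, ?_, rfl⟩,
      Or.inr (Or.inl ⟨a + 1, b, w, ?_, hw, ?_, ?_, rfl⟩), ?_⟩
    · rwa [mulA0]
    · rw [mulA0, mulA1]; push_cast; ring
    · rw [mulA0, hv]; linarith
    · rwa [mulB1]
    · rw [mulB0, mulB1, hv]; push_cast; ring
    · rwa [mulB1]
    · rw [mulA0, mulB1]
      have := step_up β α (x 1) w a b hβ hα hu hw hb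
      rw [← hv, mul_comm β α, ← hL] at this
      linarith [GG_rec a, HH_rec L a b]
  · refine ⟨_, _, Or.inr (Or.inr ⟨mulA_init α, rfl⟩),
      Or.inr (Or.inl ⟨0, 0, 0, ?_, le_rfl, ?_, ?_, rfl⟩), ?_⟩
    · rw [mulB1]; simp
    · rw [mulB0, mulB1]; simp
    · rw [mulB1]; simp
    · rw [mulB1]; simp; linarith

lemma RU_norm (α β L C Φ : ℝ) (hα : 1 ≤ α) (hβ : 1 ≤ β) (hL : 0 ≤ L)
    (hC : C = Real.log (2 + α) + Real.log (2 + β))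
    (hΦ : 0 ≤ Φ) (x : Fin 2 → ℝ) (φ : ℝ) (h : RU α β L C Φ x φ) :
    φ ≤ -Real.log (nrm2 x) := by
  have lα := Real.log_nonneg hα
  have lβ := Real.log_nonneg hβ
  have lα2 := Real.log_nonneg (show 1 ≤ 2 + α by linarith)
  have lβ2 := Real.log_nonneg (show 1 ≤ 2 + β by linarith)
  rcases h with ⟨a, b, w, hu, hw, hv, hb, rfl⟩ | ⟨a, b, w, hu, hw, hv, hb, rfl⟩ | ⟨rfl, rfl⟩
  · have hv1 : 0 < x 1 := by rw [hv]; positivity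
    have := norm_up α β (x 0) w (nrm2 x) a b hα hβ hu hw hb (hu.trans_le (le_nrm2_0 x))
      (by rw [← hv]; exact nrm2_le x hu.le hv1.le)
    linarith [HH_nonneg L hL a b]
  · have hv1 : 0 < x 0 := by rw [hv]; positivity
    have := norm_up β α (x 1) w (nrm2 x) a b hβ hα hu hw hb (hu.trans_le (le_nrm2_1 x))
      (by rw [← hv, add_comm]; exact nrm2_le x hv1.le hu.le)
    linarith [HH_nonneg L hL a b]
  · simpa [nrm2] using hΦ

theorem explicit_bounds (α β lam : ℝ) (hα : 1 ≤ α) (hβ : 1 ≤ β)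
    (hlam : Tendsto (fun N : ℕ =>
        ((N : ℝ))⁻¹ * ((2 : ℝ) ^ N)⁻¹ *
          ∑ i : Fin N → Fin 2,
            Real.log (nrm2 ((wordProd !![1, 0; α, 1] !![1, β; 0, 1] N i).mulVec ![0, 1])))
      atTop (nhds lam)) :
    kappa + Real.log (α * β) ≤ 4 * lam ∧
      4 * lam ≤ kappa + Real.log (Real.sqrt (α * β) + 1 / Real.sqrt (α * β)) +
        (1 / 2) * Real.log (1 + α * β) := by
  have hα0 : 0 < α := by linarith
  have hβ0 : 0 < β := by linarith
  have hc0 : 0 < α * β := by positivity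
  have hlog : Real.log (α * β) = Real.log α + Real.log β :=
    Real.log_mul hα0.ne' hβ0.ne'
  rw [kappa_eq]
  constructor
  · set ρ := (GG 0 + (Real.log α + Real.log β) / 2) / 2 with hρ
    set Φ := min 0 (Real.log β / 2 - 2 * ρ) with hΦ
    have key := limit_lower _ ρ Φ lam (fun N => generic_lower _ _ (fun x => Real.log (nrm2 x))
      (RL α β Φ) ρ (RL_step α β ρ Φ hα hβ (by linarith) (min_le_right _ _))
      (RL_norm α β Φ hα hβ (min_le_left _ _)) N ![0, 1] Φ (Or.inr (Or.inr ⟨rfl, rfl⟩))) hlam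
    linarith
  · set L := Real.log (1 + 1 / (α * β)) with hL
    have hL0 : 0 ≤ L := Real.log_nonneg (by
      have : 0 < 1 / (α * β) := by positivity
      linarith)
    set ρ := (GG 0 + (Real.log α + Real.log β) / 2 + 3 * L / 4) / 2 with hρ
    set C := Real.log (2 + α) + Real.log (2 + β) with hC
    set Φ := max 0 (GG 0 + HH L 0 0 + Real.log β / 2 + C - 2 * ρ) with hΦ
    have hneg := hlam.neg
    have key := limit_lower
      (fun N => ∑ i : Fin N → Fin 2,
        -Real.log (nrm2 ((wordProd !![1, 0; α, 1] !![1, β; 0, 1] N i).mulVec ![0, 1])))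
      (-ρ) (-Φ) (-lam)
      (fun N => generic_lower _ _ (fun x => -Real.log (nrm2 x))
        (RU α β L C Φ) (-ρ) (RU_step α β ρ L C Φ hα hβ hL (by linarith) (le_max_right _ _))
        (RU_norm α β L C Φ hα hβ hL0 hC (le_max_left _ _)) N ![0, 1] (-Φ)
        (Or.inr (Or.inr ⟨rfl, rfl⟩)))
      (by simpa only [Finset.sum_neg_distrib, mul_neg] using hneg)
    have hs : 0 < Real.sqrt (α * β) := Real.sqrt_pos.2 hc0
    have e1 : Real.sqrt (α * β) + 1 / Real.sqrt (α * β) = (1 + α * β) / Real.sqrt (α * β) := by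
      field_simp
      rw [Real.sq_sqrt hc0.le]
      ring
    have e2 : 1 + 1 / (α * β) = (1 + α * β) / (α * β) := by
      field_simp
      ring
    have e3 : L = Real.log (1 + α * β) - Real.log (α * β) := by
      rw [hL, e2, Real.log_div (by positivity) (by positivity)]
    rw [e1, Real.log_div (by positivity) (by positivity), Real.log_sqrt hc0.le]
    linarith

end
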